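/- arXiv:2601.20901 — 2 statements merged into one kernel-verified Lean document; each statement's English description precedes it below -/
import Mathlib

section
/- Let P and Q be probability measures on a measurable space Ω, and let ε ≥ 0 and δ ≥ 0. Suppose P and Q are (ε,δ)-indistinguishable, i.e., for every measurable set A ⊆ Ω, P(A) ≤ e^ε·Q(A) + δ and Q(A) ≤ e^ε·P(A) + δ. Then for every measurable set A, P(A) − Q(A) ≤ (e^ε − 1 + 2δ)/(e^ε + 1); hence the total variation distance satisfies TV(P,Q) = sup_{A measurable} |P(A) − Q(A)| ≤ (e^ε − 1 + 2δ)/(e^ε + 1). -/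
open MeasureTheory Real

/-- One-sided form of the total variation bound: it uses the indistinguishability inequality for
`(P, Q)` on `A` and the one for `(Q, P)` on `Aᶜ`. -/
theorem measureReal_sub_le_of_indistinguishable {Ω : Type*} [MeasurableSpace Ω]
    (P Q : Measure Ω) [IsProbabilityMeasure P] [IsProbabilityMeasure Q] {ε δ : ℝ} {A : Set Ω}
    (hA : MeasurableSet A) (hPQ : P.real A ≤ Real.exp ε * Q.real A + δ)
    (hQP : Q.real Aᶜ ≤ Real.exp ε * P.real Aᶜ + δ) :
    P.real A - Q.real A ≤ (Real.exp ε - 1 + 2 * δ) / (Real.exp ε + 1) := by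
  rw [probReal_compl_eq_one_sub hA, probReal_compl_eq_one_sub hA] at hQP
  rw [le_div_iff₀ (by positivity)]
  linarith

/-- **Hypothesis-testing bound on total variation under (ε,δ)-DP (inequality (3)).**
If `P` and `Q` are probability measures that are `(ε,δ)`-indistinguishable,
then for every measurable `A`, `P(A) − Q(A) ≤ (e^ε − 1 + 2δ)/(e^ε + 1)`, and
hence `|P(A) − Q(A)| ≤ (e^ε − 1 + 2δ)/(e^ε + 1)` for all measurable `A`, i.e.
the total variation distance obeys the same bound. -/
theorem tv_le_of_dp {Ω : Type*} [MeasurableSpace Ω]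
    (P Q : Measure Ω) [IsProbabilityMeasure P] [IsProbabilityMeasure Q]
    (ε δ : ℝ) (hε : 0 ≤ ε) (hδ : 0 ≤ δ)
    (hPQ : ∀ A : Set Ω, MeasurableSet A →
      (P A).toReal ≤ Real.exp ε * (Q A).toReal + δ)
    (hQP : ∀ A : Set Ω, MeasurableSet A →
      (Q A).toReal ≤ Real.exp ε * (P A).toReal + δ) :
    (∀ A : Set Ω, MeasurableSet A →
      (P A).toReal - (Q A).toReal ≤ (Real.exp ε - 1 + 2 * δ) / (Real.exp ε + 1)) ∧
    (∀ A : Set Ω, MeasurableSet A →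
      |(P A).toReal - (Q A).toReal| ≤ (Real.exp ε - 1 + 2 * δ) / (Real.exp ε + 1)) := by
  have bound_PQ (A : Set Ω) (hA : MeasurableSet A) :=
    measureReal_sub_le_of_indistinguishable P Q hA (hPQ A hA) (hQP Aᶜ hA.compl)
  have bound_QP (A : Set Ω) (hA : MeasurableSet A) :=
    measureReal_sub_le_of_indistinguishable Q P hA (hQP A hA) (hPQ Aᶜ hA.compl)
  exact ⟨bound_PQ, fun A hA => abs_sub_le_iff.mpr ⟨bound_PQ A hA, bound_QP A hA⟩⟩
end

section
/- Let P and Q be probability measures on a measurable space Ω, let ε ≥ 0 and δ ≥ 0, and suppose for every measurable set A ⊆ Ω that P(A) ≤ e^ε·Q(A) + δ and Q(A) ≤ e^ε·P(A) + δ. Consider the binary distinguishing game in which a bit b is uniform on {0,1} and a view V is drawn from P if b = 1 and from Q if b = 0. Then every measurable distinguisher A ⊆ Ω has success probability (1/2)·P(A) + (1/2)·(1 − Q(A)) ≤ 1/2 + (1/2)·(e^ε − 1 + 2δ)/(e^ε + 1); equivalently, its normalized advantage 2·Pr[correct] − 1 is at most (e^ε − 1 + 2δ)/(e^ε + 1).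 -/
open MeasureTheory

/-- **DP bound on the distinguishing advantage (Theorem 2, inequalities (1)+(3)).**
If `P` and `Q` are probability measures that are `(ε,δ)`-indistinguishable, then
in the distinguishing game where a uniform bit `b` selects the view `V ∼ P`
(if `b = 1`) or `V ∼ Q` (if `b = 0`), every measurable distinguisher `A` has
success probability `(1/2)·P(A) + (1/2)·(1 − Q(A))` at most
`1/2 + (1/2)·(e^ε − 1 + 2δ)/(e^ε + 1)`; equivalently, its normalized advantage
`2·Pr[correct] − 1` is at most `(e^ε − 1 + 2δ)/(e^ε + 1)`. -/
theorem distinguisher_advantage_le_dp {Ω : Type*} [MeasurableSpace Ω]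
    (P Q : Measure Ω) [IsProbabilityMeasure P] [IsProbabilityMeasure Q]
    (ε δ : ℝ) (hε : 0 ≤ ε) (hδ : 0 ≤ δ)
    (hPQ : ∀ A : Set Ω, MeasurableSet A →
      (P A).toReal ≤ Real.exp ε * (Q A).toReal + δ)
    (hQP : ∀ A : Set Ω, MeasurableSet A →
      (Q A).toReal ≤ Real.exp ε * (P A).toReal + δ)
    (A : Set Ω) (hA : MeasurableSet A) :
    (1 / 2) * (P A).toReal + (1 / 2) * (1 - (Q A).toReal)
        ≤ 1 / 2 + (1 / 2) * ((Real.exp ε - 1 + 2 * δ) / (Real.exp ε + 1)) ∧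
    2 * ((1 / 2) * (P A).toReal + (1 / 2) * (1 - (Q A).toReal)) - 1
        ≤ (Real.exp ε - 1 + 2 * δ) / (Real.exp ε + 1) := by
  have h_adv : (P A).toReal - (Q A).toReal
      ≤ (Real.exp ε - 1 + 2 * δ) / (Real.exp ε + 1) := by
    have hP : (P Aᶜ).toReal = 1 - (P A).toReal := probReal_compl_eq_one_sub hA
    have hQ : (Q Aᶜ).toReal = 1 - (Q A).toReal := probReal_compl_eq_one_sub hA
    have h_compl := hQP Aᶜ hA.compl
    rw [hP, hQ] at h_compl
    rw [le_div_iff₀ (by positivity)]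
    linarith [hPQ A hA]
  constructor <;> linarith
end
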